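/- arXiv:2007.08731 — 3 statements merged into one kernel-verified Lean document; each statement's English description precedes it below -/
import Mathlib

section
/- Let k be a field, M a finite-dimensional k-vector space, and x a nilpotent endomorphism of M. Then there exists a Deligne filtration for x, and it is unique: any two increasing families of subspaces satisfying the defining conditions of a Deligne filtration for x coincide. -/
/-- A **Deligne filtration** for a nilpotent endomorphism `x` of a finite-dimensional vector
space `M`: an increasing family of subspaces `F i`, `i : ℤ`, which is `⊥` for `i` small enough
and `⊤` for `i` large enough, with `x (F i) ⊆ F (i-2)`, and such that for every `i ≥ 0` the map
`Gr^i M → Gr^{-i} M` induced by `x^i` is an isomorphism (`Gr^i M = F i / F (i-1)`).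
Surjectivity resp. injectivity of the induced map on the subquotients is expressed
elementwise. -/
structure IsDeligneFiltration (k : Type*) [Field k] {M : Type*} [AddCommGroup M] [Module k M]
    (F : ℤ → Submodule k M) (x : M →ₗ[k] M) : Prop where
  mono : Monotone F
  eventually_bot : ∃ a : ℤ, ∀ i ≤ a, F i = ⊥
  eventually_top : ∃ b : ℤ, ∀ i : ℤ, b ≤ i → F i = ⊤
  shift : ∀ i : ℤ, ∀ v ∈ F i, x v ∈ F (i - 2)
  gr_surjective : ∀ i : ℤ, 0 ≤ i → ∀ v ∈ F (-i), ∃ u ∈ F i, v - (x ^ i.toNat) u ∈ F (-i - 1)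
  gr_injective : ∀ i : ℤ, 0 ≤ i → ∀ u ∈ F i, (x ^ i.toNat) u ∈ F (-i - 1) → u ∈ F (i - 1)

theorem delF_image {k : Type*} [Field k] {M : Type*} [AddCommGroup M] [Module k M]
    {F : ℤ → Submodule k M} {x : M →ₗ[k] M} (h : IsDeligneFiltration k F x) (n : ℕ) :
    ∀ v ∈ F (-(n : ℤ)), ∃ u ∈ F (n : ℤ), (x ^ n) u = v := by
  obtain ⟨a, ha⟩ := h.eventually_bot
  have key : ∀ d : ℕ, ∀ n : ℕ, -(n : ℤ) ≤ a + d → ∀ v ∈ F (-(n : ℤ)),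
      ∃ u ∈ F (n : ℤ), (x ^ n) u = v := by
    intro d
    induction d with
    | zero =>
      intro n hn v hv
      rw [ha _ (by simpa using hn)] at hv
      exact ⟨0, Submodule.zero_mem _, by simp [(Submodule.mem_bot k).1 hv]⟩
    | succ d ih =>
      intro n hn v hv
      obtain ⟨u, hu, huv⟩ := h.gr_surjective n (by positivity) v hv
      rw [show (-(n : ℤ) - 1) = -((n + 1 : ℕ) : ℤ) by push_cast; ring] at huv
      obtain ⟨w, hw, hwv⟩ := ih (n + 1) (by push_cast at hn ⊢; omega) _ huv
      refine ⟨u + x w, Submodule.add_mem _ hu (h.mono ?_ (h.shift _ _ hw)), ?_⟩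
      · push_cast; omega
      · rw [pow_succ, Module.End.mul_apply] at hwv
        rw [map_add, hwv]
        simp
  exact key (-(n : ℤ) - a).toNat n (by omega)

theorem delF_pow {k : Type*} [Field k] {M : Type*} [AddCommGroup M] [Module k M]
    {F : ℤ → Submodule k M} {x : M →ₗ[k] M} (h : ∀ i : ℤ, ∀ v ∈ F i, x v ∈ F (i - 2)) (n : ℕ) :
    ∀ i : ℤ, ∀ v ∈ F i, (x ^ n) v ∈ F (i - 2 * n) := by
  induction n with
  | zero => intro i v hv; simpa using hv
  | succ n ih =>
    intro i v hv
    rw [pow_succ, Module.End.mul_apply]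
    have := ih _ _ (h i v hv)
    rwa [show i - 2 - 2 * (n : ℤ) = i - 2 * ((n + 1 : ℕ) : ℤ) by push_cast; ring] at this

theorem delF_le {k : Type*} [Field k] {M : Type*} [AddCommGroup M] [Module k M]
    {F G : ℤ → Submodule k M} {x : M →ₗ[k] M} (hF : IsDeligneFiltration k F x)
    (hG : IsDeligneFiltration k G x) : F ≤ G := by
  obtain ⟨b, hb⟩ := hG.eventually_top
  have key : ∀ d : ℕ, ∀ n : ℕ, b ≤ n + d → F n ≤ G n := by
    intro d
    induction d with
    | zero => intro n hn; rw [hb _ (by simpa using hn)]; exact le_top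
    | succ d ih =>
      intro n hn u hu
      have h1 : u ∈ G ((n + 1 : ℕ) : ℤ) :=
        ih (n + 1) (by push_cast at hn ⊢; omega) (hF.mono (by push_cast; omega) hu)
      have h2 := delF_pow hF.shift (n + 1) _ _ hu
      rw [show (n : ℤ) - 2 * ((n + 1 : ℕ) : ℤ) = -((n + 2 : ℕ) : ℤ) by push_cast; ring] at h2
      obtain ⟨w, hw, hwu⟩ := delF_image hF _ _ h2
      have h3 := delF_pow hG.shift (n + 2) _ _ (ih (n + 2) (by push_cast at hn ⊢; omega) hw)
      rw [hwu] at h3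
      have h4 := hG.gr_injective ((n + 1 : ℕ) : ℤ) (by positivity) u h1 (by
        rw [Int.toNat_natCast]
        convert h3 using 2
        push_cast; ring)
      convert h4 using 2
      push_cast; ring
  have key' : ∀ n : ℕ, F n ≤ G n := fun n => key (b - n).toNat n (by omega)
  intro i
  obtain ⟨n, rfl | rfl⟩ := i.eq_nat_or_neg
  · exact key' n
  · intro v hv
    obtain ⟨u, hu, rfl⟩ := delF_image hF n v hv
    have := delF_pow hG.shift n _ _ (key' n hu)
    convert this using 2
    ring

/-- The explicit filtration. -/
def delW {k : Type*} [Field k] {M : Type*} [AddCommGroup M] [Module k M]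
    (x : M →ₗ[k] M) (i : ℤ) : Submodule k M :=
  ⨆ j : ℕ, LinearMap.ker (x ^ (i + 1 + j).toNat) ⊓ LinearMap.range (x ^ j)

theorem delW_image {k : Type*} [Field k] {M : Type*} [AddCommGroup M] [Module k M]
    (x : M →ₗ[k] M) (n : ℕ) : delW x (-(n : ℤ)) ≤ (delW x n).map (x ^ n) := by
  refine iSup_le fun j => ?_
  rintro v ⟨hv, w, rfl⟩
  by_cases hj : j < n
  · rw [show (-(n : ℤ) + 1 + j).toNat = 0 by omega] at hv
    have : (x ^ j) w = 0 := by simpa using hv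
    rw [this]; exact Submodule.zero_mem _
  · obtain ⟨m, rfl⟩ := Nat.exists_eq_add_of_le (not_lt.1 hj)
    refine ⟨(x ^ m) w, ?_, ?_⟩
    · refine Submodule.mem_iSup_of_mem m ⟨?_, w, rfl⟩
      have hv' : (x ^ (m + 1)) ((x ^ (n + m)) w) = 0 := by
        rw [show (-(n : ℤ) + 1 + (n + m : ℕ)).toNat = m + 1 by omega] at hv
        exact hv
      show (x ^ ((n : ℤ) + 1 + m).toNat) ((x ^ m) w) = 0
      rw [show ((n : ℤ) + 1 + m).toNat = n + 1 + m by omega]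
      rw [← hv', ← Module.End.mul_apply, ← Module.End.mul_apply, ← pow_add, ← pow_add]
      congr 2; ring
    · rw [← Module.End.mul_apply, ← pow_add]

theorem delW_ker_mono {k : Type*} [Field k] {M : Type*} [AddCommGroup M] [Module k M]
    (x : M →ₗ[k] M) {m n : ℕ} (h : m ≤ n) : LinearMap.ker (x ^ m) ≤ LinearMap.ker (x ^ n) := by
  obtain ⟨d, rfl⟩ := Nat.exists_eq_add_of_le h
  intro v hv
  have hv' : (x ^ m) v = 0 := hv
  show (x ^ (m + d)) v = 0
  rw [add_comm, pow_add, Module.End.mul_apply, hv', map_zero]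

theorem delW_shift {k : Type*} [Field k] {M : Type*} [AddCommGroup M] [Module k M]
    (x : M →ₗ[k] M) (i : ℤ) : ∀ v ∈ delW x i, x v ∈ delW x (i - 2) := by
  show delW x i ≤ (delW x (i - 2)).comap x
  refine iSup_le fun j => ?_
  rintro v ⟨hv, w, rfl⟩
  refine Submodule.mem_iSup_of_mem (j + 1) ⟨?_, w, by rw [pow_succ', Module.End.mul_apply]⟩
  have hv' : (x ^ (i + 1 + j).toNat) ((x ^ j) w) = 0 := hv
  show (x ^ (i - 2 + 1 + (j + 1 : ℕ)).toNat) (x ((x ^ j) w)) = 0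
  by_cases hij : i + 1 + j ≤ 0
  · rw [show (i + 1 + j).toNat = 0 by omega] at hv'
    have : (x ^ j) w = 0 := by simpa using hv'
    rw [this, map_zero, map_zero]
  · rw [show (i + 1 + j).toNat = (i - 2 + 1 + (j + 1 : ℕ)).toNat + 1 by push_cast; omega,
      pow_succ, Module.End.mul_apply] at hv'
    exact hv'

theorem delW_isDeligne {k : Type*} [Field k] {M : Type*} [AddCommGroup M] [Module k M]
    (x : M →ₗ[k] M) (hx : IsNilpotent x) : IsDeligneFiltration k (delW x) x where
  mono := fun i i' h => iSup_mono fun j => inf_le_inf_right _ (delW_ker_mono x (by omega))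
  eventually_bot := by
    obtain ⟨N, hN⟩ := hx
    refine ⟨-N, fun i hi => ?_⟩
    rw [eq_bot_iff]
    refine iSup_le fun j => ?_
    rintro v ⟨hv, w, rfl⟩
    by_cases hj : N ≤ j
    · rw [pow_eq_zero_of_le hj hN]; simp
    · rw [show (i + 1 + j).toNat = 0 by omega] at hv
      simpa using hv
  eventually_top := by
    obtain ⟨N, hN⟩ := hx
    refine ⟨N, fun i hi => ?_⟩
    rw [eq_top_iff]
    intro v _
    refine Submodule.mem_iSup_of_mem 0 ⟨?_, v, by simp⟩
    show (x ^ (i + 1 + (0 : ℕ)).toNat) v = 0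
    rw [pow_eq_zero_of_le (by push_cast; omega) hN]; simp
  shift := delW_shift x
  gr_surjective := by
    intro i hi v hv
    lift i to ℕ using hi
    obtain ⟨u, hu, rfl⟩ := delW_image x i hv
    exact ⟨u, hu, by simp⟩
  gr_injective := by
    intro i hi u _ hu
    lift i to ℕ using hi
    rw [show (-(i : ℤ) - 1) = -((i + 1 : ℕ) : ℤ) by push_cast; ring, Int.toNat_natCast] at hu
    obtain ⟨w, hw, hwu⟩ := delW_image x (i + 1) hu
    have h1 := delW_shift x _ _ hw
    rw [show (((i + 1 : ℕ) : ℤ) - 2) = (i : ℤ) - 1 by push_cast; ring] at h1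
    have h2 : u - x w ∈ delW x ((i : ℤ) - 1) := by
      refine Submodule.mem_iSup_of_mem 0 ⟨?_, u - x w, by simp⟩
      show (x ^ ((i : ℤ) - 1 + 1 + (0 : ℕ)).toNat) (u - x w) = 0
      rw [show ((i : ℤ) - 1 + 1 + (0 : ℕ)).toNat = i by push_cast; omega, map_sub, ← hwu,
        pow_succ, Module.End.mul_apply, sub_self]
    simpa using Submodule.add_mem _ h2 h1

/-- **Existence and uniqueness of the Deligne filtration** of a nilpotent endomorphism of a
finite-dimensional vector space. -/
theorem deligneFiltration_exists_unique {k : Type*} [Field k]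
    {M : Type*} [AddCommGroup M] [Module k M] [FiniteDimensional k M]
    (x : M →ₗ[k] M) (hx : IsNilpotent x) :
    (∃ F : ℤ → Submodule k M, IsDeligneFiltration k F x) ∧
      ∀ F G : ℤ → Submodule k M,
        IsDeligneFiltration k F x → IsDeligneFiltration k G x → F = G := by
  exact ⟨⟨delW x, delW_isDeligne x hx⟩,
    fun _ _ hF hG => le_antisymm (delF_le hF hG) (delF_le hG hF)⟩
end

section
/- Let k be a field of characteristic zero, V a vector superspace over k, x an odd endomorphism of V, and λ ∈ k a nonzero scalar. If x∘x − λ·id_V is nilpotent, then dim V₀ = dim V₁ (i.e. the superdimension of V is zero). [Key step in identifying the semisimplification of the representation category of the minuscule supergroup 𝕄 with Rep(OSp(1|2)): any module on which the semisimple part of [x,x] acts by a nonzero scalar has superdimension zero.] -/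
def IsEvenMap (k : Type*) [Field k] {V : Type*} [AddCommGroup V] [Module k V]
    (V0 V1 : Submodule k V) (f : V →ₗ[k] V) : Prop :=
  (∀ v ∈ V0, f v ∈ V0) ∧ (∀ v ∈ V1, f v ∈ V1)

def IsOddMap (k : Type*) [Field k] {V : Type*} [AddCommGroup V] [Module k V]
    (V0 V1 : Submodule k V) (f : V →ₗ[k] V) : Prop :=
  (∀ v ∈ V0, f v ∈ V1) ∧ (∀ v ∈ V1, f v ∈ V0)

/-- If `x` is an odd endomorphism of a vector superspace `V` over a field of characteristic
zero and `x∘x − λ·id` is nilpotent for some nonzero scalar `λ`, then the superdimension of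
`V` is zero, i.e. `dim V₀ = dim V₁`. -/
theorem superdim_eq_zero_of_odd_sqrt_scalar {k : Type*} [Field k] [CharZero k]
    (V : Type*) [AddCommGroup V] [Module k V] [FiniteDimensional k V]
    (V0 V1 : Submodule k V) (hcompl : IsCompl V0 V1)
    (x : V →ₗ[k] V) (hodd : IsOddMap k V0 V1 x)
    (lam : k) (hlam : lam ≠ 0)
    (hnil : IsNilpotent (x ∘ₗ x - lam • LinearMap.id)) :
    Module.finrank k V0 = Module.finrank k V1 := by
  have hinj : ∀ v, x v = 0 → v = 0 := by
    intro v hv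
    obtain ⟨n, hn⟩ := hnil
    have h : ∀ m : ℕ, ((x ∘ₗ x - lam • LinearMap.id : Module.End k V) ^ m) v
        = (-lam) ^ m • v := by
      intro m
      induction m with
      | zero => simp
      | succ m ih =>
        rw [pow_succ', Module.End.mul_apply, ih, map_smul, pow_succ, mul_smul]
        simp [hv]
    have h2 := h n
    rw [hn, LinearMap.zero_apply] at h2
    exact (smul_eq_zero.mp h2.symm).resolve_left (pow_ne_zero _ (neg_ne_zero.mpr hlam))
  have hx : Function.Injective x := (injective_iff_map_eq_zero x).mpr hinj
  apply le_antisymm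
  · refine LinearMap.finrank_le_finrank_of_injective (f := x.restrict hodd.1) ?_
    intro a b hab
    exact Subtype.ext (hx (congrArg Subtype.val hab))
  · refine LinearMap.finrank_le_finrank_of_injective (f := x.restrict hodd.2) ?_
    intro a b hab
    exact Subtype.ext (hx (congrArg Subtype.val hab))
end

section
/- Let k be a field, and let C and D be k-linear abelian symmetric monoidal categories in which the tensor product is k-bilinear and exact in each variable, every object has a (left and right) dual, the unit object 𝟙 is simple, and End(𝟙) = k. Let F : C → D be a k-linear symmetric monoidal functor (not assumed exact). If F(M) ≅ 0 for some nonzero object M of C, then F(P) ≅ 0 for every projective object P of C. -/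
open CategoryTheory CategoryTheory.Limits CategoryTheory.MonoidalCategory

/-- **A symmetric monoidal `k`-linear functor between tensor categories that kills a nonzero
object kills all projectives.**  Here `C` and `D` are `k`-linear abelian rigid symmetric
monoidal categories with biexact `k`-bilinear tensor product, simple unit and `End 𝟙 = k`,
and `F : C ⥤ D` is a `k`-linear symmetric monoidal functor (not assumed exact). -/
theorem functor_killing_object_kills_projectives
    {k : Type*} [Field k]
    {C : Type*} [Category C] [Abelian C] [Linear k C]
    [MonoidalCategory C] [SymmetricCategory C] [MonoidalPreadditive C] [MonoidalLinear k C]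
    [RigidCategory C] [Simple (𝟙_ C)]
    (hEndC : Function.Bijective (algebraMap k (End (𝟙_ C))))
    [∀ X : C, PreservesFiniteLimits (tensorLeft X)]
    [∀ X : C, PreservesFiniteColimits (tensorLeft X)]
    [∀ X : C, PreservesFiniteLimits (tensorRight X)]
    [∀ X : C, PreservesFiniteColimits (tensorRight X)]
    {D : Type*} [Category D] [Abelian D] [Linear k D]
    [MonoidalCategory D] [SymmetricCategory D] [MonoidalPreadditive D] [MonoidalLinear k D]
    [RigidCategory D] [Simple (𝟙_ D)]
    (hEndD : Function.Bijective (algebraMap k (End (𝟙_ D))))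
    [∀ X : D, PreservesFiniteLimits (tensorLeft X)]
    [∀ X : D, PreservesFiniteColimits (tensorLeft X)]
    [∀ X : D, PreservesFiniteLimits (tensorRight X)]
    [∀ X : D, PreservesFiniteColimits (tensorRight X)]
    (F : C ⥤ D) [F.Braided] [F.Additive] [F.Linear k]
    (M : C) (hM : ¬ IsZero M) (hFM : IsZero (F.obj M)) :
    ∀ P : C, Projective P → IsZero (F.obj P) := by
  intro P hP
  have hne : ε_ M Mᘁ ≠ 0 := by
    intro h
    apply hM
    have hz := ExactPairing.evaluation_coevaluation M Mᘁ
    rw [h, MonoidalPreadditive.whiskerLeft_zero, comp_zero, comp_zero] at hz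
    rw [IsZero.iff_id_eq_zero]
    have h2 : (λ_ M).inv ≫ ((λ_ M).hom ≫ (ρ_ M).inv) ≫ (ρ_ M).hom = 𝟙 M := by simp
    rw [← h2, ← hz]
    simp
  have hepi : Epi (ε_ M Mᘁ) := epi_of_nonzero_to_simple hne
  have hepi2 : Epi (P ◁ ε_ M Mᘁ) :=
    inferInstanceAs (Epi ((tensorLeft P).map (ε_ M Mᘁ)))
  have hepi3 : Epi (P ◁ ε_ M Mᘁ ≫ (ρ_ P).hom) := epi_comp _ _
  have hs := Projective.factorThru_comp (𝟙 P) (P ◁ ε_ M Mᘁ ≫ (ρ_ P).hom)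
  have hz1 : IsZero (F.obj Mᘁ ⊗ F.obj M) :=
    (tensorLeft (F.obj Mᘁ)).map_isZero hFM
  have hz2 : IsZero (F.obj (Mᘁ ⊗ M)) :=
    hz1.of_iso (Functor.Monoidal.μIso F Mᘁ M).symm
  have hz3 : IsZero (F.obj P ⊗ F.obj (Mᘁ ⊗ M)) :=
    (tensorLeft (F.obj P)).map_isZero hz2
  have hz4 : IsZero (F.obj (P ⊗ (Mᘁ ⊗ M))) :=
    hz3.of_iso (Functor.Monoidal.μIso F P (Mᘁ ⊗ M)).symm
  rw [IsZero.iff_id_eq_zero, ← F.map_id, ← hs, F.map_comp]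
  rw [hz4.eq_of_tgt (F.map _) 0, zero_comp]
end
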